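/- arXiv:2305.12340 — 3 statements merged into one kernel-verified Lean document; each statement's English description precedes it below -/
import Mathlib

section
/- Let n ≥ 1 and let μ₀ be a Borel probability measure on ℝ^n that is absolutely continuous with respect to the Lebesgue measure. Let φ : [0,∞) → ℝ be measurable with ∫∫ φ(‖x − y‖)² ‖x − y‖² dμ₀(y) dμ₀(x) < ∞. Then ∫∫∫ φ(‖x − y‖) φ(‖x − z‖) ⟨y − x, z − x⟩ dμ₀(x) dμ₀(y) dμ₀(z) ≥ 0. -/
open MeasureTheory
open scoped ENNReal RealInnerProductSpace

/-- nonnegativity of the cross term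
`∫∫∫ φ(‖x−y‖)φ(‖x−z‖)⟨y−x, z−x⟩ dμ₀(x)dμ₀(y)dμ₀(z) ≥ 0` for absolutely continuous `μ₀`. -/
theorem crossTerm_nonneg
    (n : ℕ) (hn : 1 ≤ n)
    (μ₀ : Measure (EuclideanSpace ℝ (Fin n))) [IsProbabilityMeasure μ₀]
    (hμ₀ : μ₀ ≪ volume)
    (φ : ℝ → ℝ) (hφ : Measurable φ)
    (hφint : Integrable (fun p : EuclideanSpace ℝ (Fin n) × EuclideanSpace ℝ (Fin n) =>
      (φ ‖p.1 - p.2‖) ^ 2 * ‖p.1 - p.2‖ ^ 2) (μ₀.prod μ₀)) :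
    0 ≤ ∫ p : EuclideanSpace ℝ (Fin n) ×
        (EuclideanSpace ℝ (Fin n) × EuclideanSpace ℝ (Fin n)),
        φ ‖p.1 - p.2.1‖ * φ ‖p.1 - p.2.2‖ * ⟪p.2.1 - p.1, p.2.2 - p.1⟫
        ∂(μ₀.prod (μ₀.prod μ₀)) := by
  set F : EuclideanSpace ℝ (Fin n) → EuclideanSpace ℝ (Fin n) → EuclideanSpace ℝ (Fin n) :=
    fun x y => φ ‖x - y‖ • (y - x) with hF
  have hFm : ∀ x, AEStronglyMeasurable (F x) μ₀ := by
    intro x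
    have : Measurable (F x) := by
      simp only [hF]
      fun_prop
    exact this.aestronglyMeasurable
  have key : ∀ᵐ x ∂μ₀, 0 ≤ ∫ q : EuclideanSpace ℝ (Fin n) × EuclideanSpace ℝ (Fin n),
      ⟪F x q.1, F x q.2⟫ ∂(μ₀.prod μ₀) := by
    filter_upwards [hφint.prod_right_ae] with x hx
    have hL2 : MemLp (F x) 2 μ₀ := by
      rw [memLp_two_iff_integrable_sq_norm (hFm x)]
      refine hx.congr (Filter.Eventually.of_forall fun y => ?_)
      simp only [hF, norm_smul, mul_pow, Real.norm_eq_abs, sq_abs, norm_sub_rev y x]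
    have hI : Integrable (F x) μ₀ := hL2.integrable (by norm_num)
    by_cases hi : Integrable (fun q : EuclideanSpace ℝ (Fin n) × EuclideanSpace ℝ (Fin n) =>
      ⟪F x q.1, F x q.2⟫) (μ₀.prod μ₀)
    · rw [integral_prod _ hi]
      have h1 : ∀ y, ∫ z, ⟪F x y, F x z⟫ ∂μ₀ = ⟪∫ z, F x z ∂μ₀, F x y⟫ := fun y => by
        rw [integral_inner hI, real_inner_comm]
      simp only [h1]
      rw [integral_inner hI]
      exact real_inner_self_nonneg
    · rw [integral_undef hi]
  have heq : (fun p : EuclideanSpace ℝ (Fin n) ×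
        (EuclideanSpace ℝ (Fin n) × EuclideanSpace ℝ (Fin n)) =>
        φ ‖p.1 - p.2.1‖ * φ ‖p.1 - p.2.2‖ * ⟪p.2.1 - p.1, p.2.2 - p.1⟫)
      = fun p => ⟪F p.1 p.2.1, F p.1 p.2.2⟫ := by
    funext p
    simp only [hF, real_inner_smul_left, real_inner_smul_right]
    ring
  rw [heq]
  by_cases hi : Integrable (fun p : EuclideanSpace ℝ (Fin n) ×
        (EuclideanSpace ℝ (Fin n) × EuclideanSpace ℝ (Fin n)) =>
        ⟪F p.1 p.2.1, F p.1 p.2.2⟫) (μ₀.prod (μ₀.prod μ₀))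
  · rw [integral_prod _ hi]
    exact integral_nonneg_of_ae key
  · rw [integral_undef hi]
end

section
/- Fix integers n ≥ 1 and N ≥ 2, let σ be the uniform (normalized surface) probability measure on 𝕊^n ⊂ ℝ^{n+1}, and let μ := σ^{⊗N} on (𝕊^n)^N. Then for every measurable φ : [0,π] → ℝ with ‖φ‖²_{L²(ρ)} := (1/(N(N−1))) Σ_{i ≠ j} ∫ φ(d(x_i,x_j))² d(x_i,x_j)² dμ(X) < ∞, one has the equality ‖f_φ‖²_{L²(μ)} = ((N−1)/N²) ‖φ‖²_{L²(ρ)}. Consequently, the infimum of ‖f_φ‖_{L²(μ)} / ‖φ‖_{L²(ρ)} over nonzero such φ equals √(N−1)/N, so the coercivity constant √(N−1)/N is sharp on the sphere and cannot be improved by restricting φ to any nontrivial subspace. -/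
open MeasureTheory Finset
open scoped ENNReal RealInnerProductSpace

/-- Geodesic distance on the unit sphere: `d(x,y) = arccos⟨x,y⟩`. -/
noncomputable def sphereDist {n : ℕ} (x y : EuclideanSpace ℝ (Fin (n + 1))) : ℝ :=
  Real.arccos ⟪x, y⟫

open Classical in
/-- The influence vector on the unit sphere:
`w(x,y) = d(x,y)·(y − ⟨x,y⟩x)/‖y − ⟨x,y⟩x‖` if `y ≠ ±x`, and `0` otherwise. -/
noncomputable def sphereW {n : ℕ} (x y : EuclideanSpace ℝ (Fin (n + 1))) :
    EuclideanSpace ℝ (Fin (n + 1)) :=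
  if y = x ∨ y = -x then 0
  else sphereDist x y • (‖y - ⟪x, y⟫ • x‖⁻¹ • (y - ⟪x, y⟫ • x))

/-- The interaction velocity field on the sphere:
`f_φ(X)_i = (1/N) ∑_{j ≠ i} φ(d(x_i,x_j)) w(x_i,x_j)`. -/
noncomputable def sphereField (n N : ℕ) (φ : ℝ → ℝ)
    (X : Fin N → EuclideanSpace ℝ (Fin (n + 1))) (i : Fin N) :
    EuclideanSpace ℝ (Fin (n + 1)) :=
  (N : ℝ)⁻¹ • ∑ j ∈ Finset.univ.erase i, φ (sphereDist (X i) (X j)) • sphereW (X i) (X j)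

/-- The squared `L²(ρ)` norm on the sphere:
`‖φ‖²_{L²(ρ)} = (1/(N(N−1))) ∑_{i≠j} ∫ φ(d(x_i,x_j))² d(x_i,x_j)² dμ(X)`. -/
noncomputable def sphereRhoSqNorm (n N : ℕ)
    (μ : Measure (Fin N → EuclideanSpace ℝ (Fin (n + 1)))) (φ : ℝ → ℝ) : ℝ≥0∞ :=
  ((N * (N - 1) : ℕ) : ℝ≥0∞)⁻¹ *
    ∑ i : Fin N, ∑ j ∈ Finset.univ.erase i,
      ∫⁻ X, ENNReal.ofReal
        ((φ (sphereDist (X i) (X j))) ^ 2 * (sphereDist (X i) (X j)) ^ 2) ∂μ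

/-- The squared `L²(μ)` norm of the interaction field on the sphere. -/
noncomputable def sphereFieldSqNorm (n N : ℕ)
    (μ : Measure (Fin N → EuclideanSpace ℝ (Fin (n + 1)))) (φ : ℝ → ℝ) : ℝ≥0∞ :=
  ∫⁻ X, ENNReal.ofReal ((N : ℝ)⁻¹ * ∑ i : Fin N, ‖sphereField n N φ X i‖ ^ 2) ∂μ

/-! ### Helper lemmas -/

/-- The weighted influence vector `φ(d(x,y)) w(x,y)`. -/
noncomputable def sphF {n : ℕ} (φ : ℝ → ℝ) (x y : EuclideanSpace ℝ (Fin (n + 1))) :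
    EuclideanSpace ℝ (Fin (n + 1)) :=
  φ (sphereDist x y) • sphereW x y

lemma measurable_sphereDist {n : ℕ} :
    Measurable fun p : EuclideanSpace ℝ (Fin (n + 1)) × EuclideanSpace ℝ (Fin (n + 1)) =>
      sphereDist p.1 p.2 := by
  unfold sphereDist
  exact (Real.continuous_arccos.comp (continuous_fst.inner continuous_snd)).measurable

lemma measurable_pair {n N : ℕ} (i j : Fin N) :
    Measurable fun X : Fin N → EuclideanSpace ℝ (Fin (n + 1)) => (X i, X j) := by
  fun_prop

lemma measurableSet_bad {n : ℕ} :
    MeasurableSet {p : EuclideanSpace ℝ (Fin (n + 1)) × EuclideanSpace ℝ (Fin (n + 1)) |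
      p.2 = p.1 ∨ p.2 = -p.1} :=
  ((isClosed_eq continuous_snd continuous_fst).union
    (isClosed_eq continuous_snd continuous_fst.neg)).measurableSet

lemma measurable_sphF {n : ℕ} {φ : ℝ → ℝ} (hφ : Measurable φ) :
    Measurable fun p : EuclideanSpace ℝ (Fin (n + 1)) × EuclideanSpace ℝ (Fin (n + 1)) =>
      sphF φ p.1 p.2 := by
  unfold sphF sphereW
  have hc : Continuous fun p : EuclideanSpace ℝ (Fin (n + 1)) × EuclideanSpace ℝ (Fin (n + 1)) =>
      p.2 - ⟪p.1, p.2⟫ • p.1 :=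
    by fun_prop
  refine (hφ.comp measurable_sphereDist).smul (Measurable.ite measurableSet_bad measurable_const ?_)
  exact measurable_sphereDist.smul ((hc.measurable.norm.inv).smul hc.measurable)

lemma measurable_dist_pair {n N : ℕ} (i j : Fin N) :
    Measurable fun X : Fin N → EuclideanSpace ℝ (Fin (n + 1)) => sphereDist (X i) (X j) := by
  have h := (measurable_sphereDist (n := n)).comp (measurable_pair (n := n) i j)
  exact h

lemma measurable_sphF_pair {n N : ℕ} {φ : ℝ → ℝ} (hφ : Measurable φ) (i j : Fin N) :
    Measurable fun X : Fin N → EuclideanSpace ℝ (Fin (n + 1)) => sphF φ (X i) (X j) := by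
  have h := (measurable_sphF (n := n) hφ).comp (measurable_pair (n := n) i j)
  exact h

lemma normal_ne_zero {n : ℕ} {x y : EuclideanSpace ℝ (Fin (n + 1))} (hx : ‖x‖ = 1) (hy : ‖y‖ = 1)
    (h1 : y ≠ x) (h2 : y ≠ -x) : y - ⟪x, y⟫ • x ≠ 0 := by
  intro h
  rw [sub_eq_zero] at h
  have h3 : |⟪x, y⟫| = 1 := by
    have := congrArg norm h
    rw [norm_smul, hx, hy] at this
    simpa using this.symm
  rcases eq_or_eq_neg_of_abs_eq h3 with h4 | h4
  · rw [h4] at h; exact h1 (by simpa using h)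
  · rw [h4] at h; exact h2 (by simpa using h)

lemma norm_sphF_sq {n : ℕ} (φ : ℝ → ℝ) {x y : EuclideanSpace ℝ (Fin (n + 1))}
    (hx : ‖x‖ = 1) (hy : ‖y‖ = 1) (h1 : y ≠ x) (h2 : y ≠ -x) :
    ‖sphF φ x y‖ ^ 2 = φ (sphereDist x y) ^ 2 * sphereDist x y ^ 2 := by
  have h := normal_ne_zero hx hy h1 h2
  unfold sphF sphereW
  rw [if_neg (by tauto), norm_smul, norm_smul, norm_smul, norm_inv, norm_norm,
    inv_mul_cancel₀ (norm_ne_zero_iff.2 h), mul_one, mul_pow]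
  simp

lemma sphF_reflection {n : ℕ} (φ : ℝ → ℝ) {x : EuclideanSpace ℝ (Fin (n + 1))} (hx : ‖x‖ = 1)
    (y : EuclideanSpace ℝ (Fin (n + 1))) :
    sphF φ x ((ℝ ∙ x).reflection y) = - sphF φ x y := by
  have hR : (ℝ ∙ x).reflection y = (2 * ⟪x, y⟫) • x - y := by
    rw [Submodule.reflection_singleton_apply]
    simp [hx, two_smul, two_mul, add_smul]
  have hi : ⟪x, (ℝ ∙ x).reflection y⟫ = ⟪x, y⟫ := by
    rw [hR, inner_sub_right, inner_smul_right, real_inner_self_eq_norm_sq, hx]; ring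
  have hd : sphereDist x ((ℝ ∙ x).reflection y) = sphereDist x y := by
    unfold sphereDist; rw [hi]
  have hxx : (ℝ ∙ x).reflection x = x :=
    Submodule.reflection_mem_subspace_eq_self (Submodule.mem_span_singleton_self x)
  have e1 : (ℝ ∙ x).reflection y = x ↔ y = x := by
    constructor
    · intro h
      exact (ℝ ∙ x).reflection.injective (h.trans hxx.symm)
    · rintro rfl; exact hxx
  have e2 : (ℝ ∙ x).reflection y = -x ↔ y = -x := by
    constructor
    · intro h
      apply (ℝ ∙ x).reflection.injective
      rw [map_neg, hxx, h]
    · rintro rfl; rw [map_neg, hxx]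
  have hn : (ℝ ∙ x).reflection y - ⟪x, y⟫ • x = -(y - ⟪x, y⟫ • x) := by
    rw [hR, two_mul, add_smul]; abel
  unfold sphF sphereW
  rw [hd, hi, hn, norm_neg]
  by_cases h : y = x ∨ y = -x
  · rw [if_pos (by rwa [e1, e2]), if_pos h]; simp
  · rw [if_neg (by rwa [e1, e2]), if_neg h, smul_neg, smul_neg, smul_neg]

section
variable {n : ℕ} {σ : Measure (EuclideanSpace ℝ (Fin (n + 1)))} [IsProbabilityMeasure σ]

lemma sigma_singleton (hn : 1 ≤ n)
    (hσsphere : σ (Metric.sphere (0 : EuclideanSpace ℝ (Fin (n + 1))) 1)ᶜ = 0)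
    (hσinv : ∀ O : EuclideanSpace ℝ (Fin (n + 1)) ≃ₗᵢ[ℝ] EuclideanSpace ℝ (Fin (n + 1)),
      Measure.map O σ = σ) (a : EuclideanSpace ℝ (Fin (n + 1))) : σ {a} = 0 := by
  by_cases ha : ‖a‖ = 1
  · by_contra h0
    have hinf : (Metric.sphere (0 : EuclideanSpace ℝ (Fin (n + 1))) 1).Infinite := by
      apply IsPreconnected.infinite_of_nontrivial
      · apply isPreconnected_sphere
        rw [← Module.finrank_eq_rank]
        simp only [finrank_euclideanSpace, Fintype.card_fin]
        exact_mod_cast (by omega : 1 < n + 1)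
      · refine ⟨a, by simpa using ha, -a, by simpa using ha, ?_⟩
        intro h
        have h2 : ⟪a, a⟫ = -⟪a, a⟫ := by
          conv_lhs => rw [h]
          rw [inner_neg_left, inner_neg_right, neg_neg, ← inner_neg_right, ← h]
        rw [real_inner_self_eq_norm_sq, ha] at h2
        norm_num at h2
    have := hinf.meas_eq_top (μ := σ) ⟨σ {a}, h0, fun b hb => ?_⟩
    · exact measure_ne_top _ _ this
    · have hb' : ‖a‖ = ‖b‖ := by rw [ha]; simpa using hb.symm
      have hr := Submodule.reflection_sub hb'
      set R := ((ℝ ∙ (a - b))ᗮ).reflection with hRdef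
      conv_rhs => rw [← hσinv R]
      rw [Measure.map_apply R.continuous.measurable (measurableSet_singleton b)]
      apply measure_mono
      rintro _ rfl
      exact hr
  · refine measure_mono_null ?_ hσsphere
    rintro _ rfl
    simpa using ha

lemma ae_norm (hσsphere : σ (Metric.sphere (0 : EuclideanSpace ℝ (Fin (n + 1))) 1)ᶜ = 0) :
    ∀ᵐ x ∂σ, ‖x‖ = 1 := by
  rw [ae_iff]
  convert hσsphere using 2
  ext x; simp

lemma ae_pi_norm {N : ℕ}
    (hσsphere : σ (Metric.sphere (0 : EuclideanSpace ℝ (Fin (n + 1))) 1)ᶜ = 0) (i : Fin N) :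
    ∀ᵐ X ∂(Measure.pi fun _ : Fin N => σ), ‖X i‖ = 1 :=
  (Measure.quasiMeasurePreserving_eval (μ := fun _ : Fin N => σ) i).ae (ae_norm hσsphere)

lemma ae_good {N : ℕ} (hn : 1 ≤ n)
    (hσsphere : σ (Metric.sphere (0 : EuclideanSpace ℝ (Fin (n + 1))) 1)ᶜ = 0)
    (hσinv : ∀ O : EuclideanSpace ℝ (Fin (n + 1)) ≃ₗᵢ[ℝ] EuclideanSpace ℝ (Fin (n + 1)),
      Measure.map O σ = σ) {i j : Fin N} (hij : j ≠ i) :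
    ∀ᵐ X ∂(Measure.pi fun _ : Fin N => σ), X j ≠ X i ∧ X j ≠ - X i := by
  obtain _ | m := N
  · exact i.elim0
  obtain ⟨k, rfl⟩ := Fin.exists_succAbove_eq hij
  have hmp := measurePreserving_piFinSuccAbove (fun _ : Fin (m + 1) => σ) i
  have key : ∀ᵐ p ∂(σ.prod (Measure.pi fun _ : Fin m => σ)), p.2 k ≠ p.1 ∧ p.2 k ≠ -p.1 := by
    have hms : MeasurableSet {p : EuclideanSpace ℝ (Fin (n + 1)) ×
        (Fin m → EuclideanSpace ℝ (Fin (n + 1))) | p.2 k ≠ p.1 ∧ p.2 k ≠ -p.1} := by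
      have := (measurableSet_bad (n := n)).compl.preimage
        (measurable_fst.prodMk ((measurable_pi_apply k).comp measurable_snd) :
          Measurable fun p : EuclideanSpace ℝ (Fin (n + 1)) ×
            (Fin m → EuclideanSpace ℝ (Fin (n + 1))) => (p.1, p.2 k))
      convert this using 1
      ext p; simp
    rw [Measure.ae_prod_iff_ae_ae hms]
    refine Filter.Eventually.of_forall fun x => ?_
    have h1 : ∀ᵐ y ∂σ, y ≠ x ∧ y ≠ -x := by
      rw [ae_iff]
      refine measure_mono_null (t := {x} ∪ {-x}) ?_
        (measure_union_null (sigma_singleton hn hσsphere hσinv _)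
          (sigma_singleton hn hσsphere hσinv _))
      intro y hy
      simp only [Set.mem_ofPred_eq, not_and_or, not_not] at hy
      exact hy
    exact (Measure.quasiMeasurePreserving_eval (μ := fun _ : Fin m => σ) k).ae h1
  exact hmp.quasiMeasurePreserving.ae key

lemma integral_sphF_zero
    (hσinv : ∀ O : EuclideanSpace ℝ (Fin (n + 1)) ≃ₗᵢ[ℝ] EuclideanSpace ℝ (Fin (n + 1)),
      Measure.map O σ = σ) (φ : ℝ → ℝ) {x : EuclideanSpace ℝ (Fin (n + 1))} (hx : ‖x‖ = 1)
    (v : EuclideanSpace ℝ (Fin (n + 1))) :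
    ∫ y, ⟪sphF φ x y, v⟫ ∂σ = 0 := by
  have hmp : MeasurePreserving (ℝ ∙ x).reflection σ σ :=
    ⟨(ℝ ∙ x).reflection.continuous.measurable, hσinv _⟩
  have := hmp.integral_comp (ℝ ∙ x).reflection.toHomeomorph.measurableEmbedding
    (fun y => ⟪sphF φ x y, v⟫)
  simp only [sphF_reflection φ hx, inner_neg_left, integral_neg] at this
  linarith

lemma integral_cross {N : ℕ}
    (hσsphere : σ (Metric.sphere (0 : EuclideanSpace ℝ (Fin (n + 1))) 1)ᶜ = 0)
    (hσinv : ∀ O : EuclideanSpace ℝ (Fin (n + 1)) ≃ₗᵢ[ℝ] EuclideanSpace ℝ (Fin (n + 1)),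
      Measure.map O σ = σ) (φ : ℝ → ℝ) {i j k : Fin N} (hij : i ≠ j) (hkj : k ≠ j)
    (hint : Integrable (fun X : Fin N → EuclideanSpace ℝ (Fin (n + 1)) =>
      ⟪sphF φ (X i) (X j), sphF φ (X i) (X k)⟫) (Measure.pi fun _ : Fin N => σ)) :
    ∫ X : Fin N → EuclideanSpace ℝ (Fin (n + 1)),
      ⟪sphF φ (X i) (X j), sphF φ (X i) (X k)⟫ ∂(Measure.pi fun _ : Fin N => σ) = 0 := by
  obtain _ | m := N
  · exact i.elim0
  obtain ⟨i, rfl⟩ := Fin.exists_succAbove_eq hij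
  obtain ⟨k, rfl⟩ := Fin.exists_succAbove_eq hkj
  have hmp := measurePreserving_piFinSuccAbove (fun _ : Fin (m + 1) => σ) j
  let g : EuclideanSpace ℝ (Fin (n + 1)) × (Fin m → EuclideanSpace ℝ (Fin (n + 1))) → ℝ :=
    fun p => ⟪sphF φ (p.2 i) p.1, sphF φ (p.2 i) (p.2 k)⟫
  have h1 := hmp.integral_comp' g
  have h2 := (hmp.integrable_comp_emb (MeasurableEquiv.measurableEmbedding _) (g := g)).1 hint
  refine h1.trans ?_
  rw [integral_prod_symm _ h2]
  apply integral_eq_zero_of_ae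
  filter_upwards [ae_pi_norm hσsphere i] with X hX
  exact integral_sphF_zero hσinv φ hX (sphF φ (X i) (X k))

lemma ae_all {N : ℕ} (hn : 1 ≤ n)
    (hσsphere : σ (Metric.sphere (0 : EuclideanSpace ℝ (Fin (n + 1))) 1)ᶜ = 0)
    (hσinv : ∀ O : EuclideanSpace ℝ (Fin (n + 1)) ≃ₗᵢ[ℝ] EuclideanSpace ℝ (Fin (n + 1)),
      Measure.map O σ = σ) (i j : Fin N) (hij : j ≠ i) :
    ∀ᵐ X ∂(Measure.pi fun _ : Fin N => σ),
      ‖X i‖ = 1 ∧ ‖X j‖ = 1 ∧ X j ≠ X i ∧ X j ≠ - X i :=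
  (ae_pi_norm hσsphere i).and ((ae_pi_norm hσsphere j).and (ae_good hn hσsphere hσinv hij))

set_option maxHeartbeats 1000000 in
lemma main_abstract {N : ℕ} (hN : 2 ≤ N)
    (μ : Measure (Fin N → EuclideanSpace ℝ (Fin (n + 1))))
    (hall : ∀ i j : Fin N, j ≠ i → ∀ᵐ X ∂μ,
      ‖X i‖ = 1 ∧ ‖X j‖ = 1 ∧ X j ≠ X i ∧ X j ≠ - X i)
    (φ : ℝ → ℝ) (hφ : Measurable φ)
    (hcross : ∀ i j k : Fin N, i ≠ j → k ≠ j →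
      Integrable (fun X : Fin N → EuclideanSpace ℝ (Fin (n + 1)) =>
        ⟪sphF φ (X i) (X j), sphF φ (X i) (X k)⟫) μ →
      ∫ X : Fin N → EuclideanSpace ℝ (Fin (n + 1)),
        ⟪sphF φ (X i) (X j), sphF φ (X i) (X k)⟫ ∂μ = 0)
    (hfin : sphereRhoSqNorm n N μ φ ≠ ⊤) :
    sphereFieldSqNorm n N μ φ =
        (((N - 1 : ℕ) : ℝ≥0∞) / ((N : ℝ≥0∞) ^ 2)) * sphereRhoSqNorm n N μ φ := by
  have hL : ∀ i j : Fin N, j ≠ i → ∫⁻ X, ENNReal.ofReal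
        ((φ (sphereDist (X i) (X j))) ^ 2 * (sphereDist (X i) (X j)) ^ 2) ∂μ =
      ∫⁻ X, ENNReal.ofReal (‖sphF φ (X i) (X j)‖ ^ 2) ∂μ := by
    intro i j hij
    apply lintegral_congr_ae
    filter_upwards [hall i j hij] with X hX
    rw [norm_sphF_sq φ hX.1 hX.2.1 hX.2.2.1 hX.2.2.2]
  have hrho : sphereRhoSqNorm n N μ φ = ((N * (N - 1) : ℕ) : ℝ≥0∞)⁻¹ *
      ∑ i : Fin N, ∑ j ∈ Finset.univ.erase i,
        ∫⁻ X, ENNReal.ofReal (‖sphF φ (X i) (X j)‖ ^ 2) ∂μ := by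
    unfold sphereRhoSqNorm
    congr 1
    refine Finset.sum_congr rfl fun i _ => Finset.sum_congr rfl fun j hj => ?_
    exact hL i j (Finset.ne_of_mem_erase hj)
  have hc0 : ((N * (N - 1) : ℕ) : ℝ≥0∞) ≠ 0 := by
    have : 0 < N * (N - 1) := Nat.mul_pos (by omega) (by omega)
    exact_mod_cast this.ne'
  have hSfin : ∑ i : Fin N, ∑ j ∈ Finset.univ.erase i,
        ∫⁻ X, ENNReal.ofReal (‖sphF φ (X i) (X j)‖ ^ 2) ∂μ ≠ ⊤ := by
    intro h
    rw [hrho, h] at hfin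
    exact hfin (ENNReal.mul_top (ENNReal.inv_ne_zero.2 (ENNReal.natCast_ne_top _)))
  have hmeas : ∀ i j : Fin N, Measurable fun X : Fin N → EuclideanSpace ℝ (Fin (n + 1)) =>
      sphF φ (X i) (X j) := fun i j =>
    measurable_sphF_pair hφ i j
  have hsq : ∀ i j : Fin N, j ≠ i → Integrable (fun X : Fin N → EuclideanSpace ℝ (Fin (n + 1)) =>
      ‖sphF φ (X i) (X j)‖ ^ 2) μ := by
    intro i j hij
    refine (lintegral_ofReal_ne_top_iff_integrable
      ((hmeas i j).norm.pow_const 2).aestronglyMeasurable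
      (Filter.Eventually.of_forall fun X => sq_nonneg _)).1 ?_
    have h1 := ENNReal.sum_ne_top.1 hSfin i (Finset.mem_univ i)
    exact ENNReal.sum_ne_top.1 h1 j (Finset.mem_erase.2 ⟨hij, Finset.mem_univ j⟩)
  have hinn : ∀ i j k : Fin N, j ≠ i → k ≠ i →
      Integrable (fun X : Fin N → EuclideanSpace ℝ (Fin (n + 1)) =>
        ⟪sphF φ (X i) (X j), sphF φ (X i) (X k)⟫) μ := by
    intro i j k hj hk
    refine ((hsq i j hj).add (hsq i k hk)).mono'
      ((hmeas i j).inner (hmeas i k)).aestronglyMeasurable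
      (Filter.Eventually.of_forall fun X => ?_)
    have := norm_inner_le_norm (𝕜 := ℝ) (sphF φ (X i) (X j)) (sphF φ (X i) (X k))
    simp only [Pi.add_apply]
    nlinarith [sq_nonneg (‖sphF φ (X i) (X j)‖ - ‖sphF φ (X i) (X k)‖),
      sq_nonneg (‖sphF φ (X i) (X j)‖), sq_nonneg (‖sphF φ (X i) (X k)‖)]
  have hexp : ∀ X : Fin N → EuclideanSpace ℝ (Fin (n + 1)),
      (N : ℝ)⁻¹ * ∑ i : Fin N, ‖sphereField n N φ X i‖ ^ 2 =
      (N : ℝ)⁻¹ * ∑ i : Fin N, ((N : ℝ)⁻¹ ^ 2 * ∑ j ∈ Finset.univ.erase i,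
        ∑ k ∈ Finset.univ.erase i, ⟪sphF φ (X i) (X j), sphF φ (X i) (X k)⟫) := by
    intro X
    congr 1
    refine Finset.sum_congr rfl fun i _ => ?_
    unfold sphereField
    rw [norm_smul, mul_pow, ← real_inner_self_eq_norm_sq (∑ j ∈ _, _), sum_inner]
    simp only [inner_sum]
    simp [sphF]
  have hI1 : ∀ i : Fin N, Integrable (fun X : Fin N → EuclideanSpace ℝ (Fin (n + 1)) =>
      ∑ j ∈ Finset.univ.erase i,
        ∑ k ∈ Finset.univ.erase i, ⟪sphF φ (X i) (X j), sphF φ (X i) (X k)⟫) μ := fun i =>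
    integrable_finsetSum _ fun j hj => integrable_finsetSum _ fun k hk =>
      hinn i j k (Finset.ne_of_mem_erase hj) (Finset.ne_of_mem_erase hk)
  have hval : ∀ i : Fin N, ∫ X : Fin N → EuclideanSpace ℝ (Fin (n + 1)),
      ∑ j ∈ Finset.univ.erase i, ∑ k ∈ Finset.univ.erase i,
        ⟪sphF φ (X i) (X j), sphF φ (X i) (X k)⟫ ∂μ =
      ∑ j ∈ Finset.univ.erase i, ∫ X, ‖sphF φ (X i) (X j)‖ ^ 2 ∂μ := by
    intro i
    rw [integral_finsetSum _ fun j hj => integrable_finsetSum _ fun k hk =>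
      hinn i j k (Finset.ne_of_mem_erase hj) (Finset.ne_of_mem_erase hk)]
    refine Finset.sum_congr rfl fun j hj => ?_
    rw [integral_finsetSum _ fun k hk =>
      hinn i j k (Finset.ne_of_mem_erase hj) (Finset.ne_of_mem_erase hk)]
    rw [Finset.sum_eq_single_of_mem j hj]
    · simp only [real_inner_self_eq_norm_sq]
    · intro k hk hkj
      exact hcross i j k (Finset.ne_of_mem_erase hj).symm hkj
        (hinn i j k (Finset.ne_of_mem_erase hj) (Finset.ne_of_mem_erase hk))
  have hfield : sphereFieldSqNorm n N μ φ = ENNReal.ofReal ((N : ℝ)⁻¹ ^ 3 *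
      ∑ i : Fin N, ∑ j ∈ Finset.univ.erase i, ∫ X, ‖sphF φ (X i) (X j)‖ ^ 2 ∂μ) := by
    unfold sphereFieldSqNorm
    rw [← ofReal_integral_eq_lintegral_ofReal]
    · congr 1
      simp only [hexp]
      rw [integral_const_mul, integral_finsetSum _ fun i _ => (hI1 i).const_mul _]
      simp only [integral_const_mul, hval]
      rw [← Finset.mul_sum]; ring
    · simp only [hexp]
      exact (integrable_finsetSum _ fun i _ => (hI1 i).const_mul _).const_mul _
    · exact Filter.Eventually.of_forall fun X => by positivity
  have hsum : ENNReal.ofReal (∑ i : Fin N, ∑ j ∈ Finset.univ.erase i,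
      ∫ X, ‖sphF φ (X i) (X j)‖ ^ 2 ∂μ) = ∑ i : Fin N, ∑ j ∈ Finset.univ.erase i,
        ∫⁻ X, ENNReal.ofReal (‖sphF φ (X i) (X j)‖ ^ 2) ∂μ := by
    have h0 : ∀ i j : Fin N, 0 ≤ ∫ X, ‖sphF φ (X i) (X j)‖ ^ 2 ∂μ := fun i j =>
      integral_nonneg fun X => sq_nonneg _
    rw [ENNReal.ofReal_sum_of_nonneg fun i _ => Finset.sum_nonneg fun j _ => h0 i j]
    refine Finset.sum_congr rfl fun i _ => ?_
    rw [ENNReal.ofReal_sum_of_nonneg fun j _ => h0 i j]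
    refine Finset.sum_congr rfl fun j hj => ?_
    exact ofReal_integral_eq_lintegral_ofReal (hsq i j (Finset.ne_of_mem_erase hj))
      (Filter.Eventually.of_forall fun X => sq_nonneg _)
  rw [hfield, hrho, ENNReal.ofReal_mul (by positivity), hsum, ← mul_assoc]
  congr 1
  have hN0 : (0 : ℝ) < N := by exact_mod_cast (by omega : 0 < N)
  have hN1 : (0 : ℝ) < ((N - 1 : ℕ) : ℝ) := by exact_mod_cast (by omega : 0 < N - 1)
  rw [← ENNReal.ofReal_natCast (N * (N - 1)), ← ENNReal.ofReal_natCast (N - 1),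
    ← ENNReal.ofReal_natCast N, ← ENNReal.ofReal_pow hN0.le,
    ← ENNReal.ofReal_div_of_pos (by positivity),
    ← ENNReal.ofReal_inv_of_pos (by push_cast; positivity), ← ENNReal.ofReal_mul (by positivity)]
  congr 1
  push_cast
  field_simp

lemma main_identity {N : ℕ} (hn : 1 ≤ n) (hN : 2 ≤ N)
    (hσsphere : σ (Metric.sphere (0 : EuclideanSpace ℝ (Fin (n + 1))) 1)ᶜ = 0)
    (hσinv : ∀ O : EuclideanSpace ℝ (Fin (n + 1)) ≃ₗᵢ[ℝ] EuclideanSpace ℝ (Fin (n + 1)),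
      Measure.map O σ = σ) (φ : ℝ → ℝ) (hφ : Measurable φ)
    (hfin : sphereRhoSqNorm n N (Measure.pi fun _ : Fin N => σ) φ ≠ ⊤) :
    sphereFieldSqNorm n N (Measure.pi fun _ : Fin N => σ) φ =
        (((N - 1 : ℕ) : ℝ≥0∞) / ((N : ℝ≥0∞) ^ 2)) *
          sphereRhoSqNorm n N (Measure.pi fun _ : Fin N => σ) φ :=
  main_abstract hN _ (ae_all hn hσsphere hσinv) φ hφ
    (fun _ _ _ hij hkj hint => integral_cross hσsphere hσinv φ hij hkj hint) hfin

lemma rho_one_ne_top {N : ℕ} (hN : 2 ≤ N) :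
    sphereRhoSqNorm n N (Measure.pi fun _ : Fin N => σ) (fun _ => 1) ≠ ⊤ := by
  have hc0 : ((N * (N - 1) : ℕ) : ℝ≥0∞) ≠ 0 := by
    have : 0 < N * (N - 1) := Nat.mul_pos (by omega) (by omega)
    exact_mod_cast this.ne'
  unfold sphereRhoSqNorm
  refine ENNReal.mul_ne_top (ENNReal.inv_ne_top.2 hc0) ?_
  refine ENNReal.sum_ne_top.2 fun i _ => ENNReal.sum_ne_top.2 fun j _ => ?_
  refine ne_top_of_le_ne_top (b := ∫⁻ X, ENNReal.ofReal (Real.pi ^ 2)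
    ∂(Measure.pi fun _ : Fin N => σ)) (by simp) (lintegral_mono fun X => ?_)
  apply ENNReal.ofReal_le_ofReal
  have h1 : 0 ≤ sphereDist (X i) (X j) := Real.arccos_nonneg _
  have h2 : sphereDist (X i) (X j) ≤ Real.pi := Real.arccos_le_pi _
  nlinarith

set_option maxHeartbeats 1000000 in
lemma rho_one_ne_zero {N : ℕ} (hn : 1 ≤ n) (hN : 2 ≤ N)
    (hσsphere : σ (Metric.sphere (0 : EuclideanSpace ℝ (Fin (n + 1))) 1)ᶜ = 0)
    (hσinv : ∀ O : EuclideanSpace ℝ (Fin (n + 1)) ≃ₗᵢ[ℝ] EuclideanSpace ℝ (Fin (n + 1)),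
      Measure.map O σ = σ) :
    sphereRhoSqNorm n N (Measure.pi fun _ : Fin N => σ) (fun _ => 1) ≠ 0 := by
  intro h
  unfold sphereRhoSqNorm at h
  rcases mul_eq_zero.1 h with h | h
  · exact ENNReal.natCast_ne_top _ (ENNReal.inv_eq_zero.1 h)
  · obtain ⟨i, j, hij⟩ : ∃ i j : Fin N, j ≠ i :=
      ⟨⟨0, by omega⟩, ⟨1, by omega⟩, by simp⟩
    have h1 := Finset.sum_eq_zero_iff.1 h i (Finset.mem_univ i)
    have h2 := Finset.sum_eq_zero_iff.1 h1 j (Finset.mem_erase.2 ⟨hij, Finset.mem_univ j⟩)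
    have hm : Measurable fun X : Fin N → EuclideanSpace ℝ (Fin (n + 1)) =>
        sphereDist (X i) (X j) :=
      measurable_dist_pair i j
    rw [lintegral_eq_zero_iff ((hm.pow_const 2).const_mul _).ennreal_ofReal] at h2
    have hF : ∀ᵐ X ∂(Measure.pi fun _ : Fin N => σ), False := by
      have hall := ae_all hn hσsphere hσinv i j hij
      filter_upwards [h2, hall] with X h3 hX
      obtain ⟨h4, h5, h6⟩ := hX
      have h7 : sphereDist (X i) (X j) = 0 := by
        simp only [Pi.zero_apply, ENNReal.ofReal_eq_zero] at h3
        nlinarith [sq_nonneg (sphereDist (X i) (X j))]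
      unfold sphereDist at h7
      rw [Real.arccos_eq_zero] at h7
      have h8 : ⟪X i, X j⟫ = 1 := by
        refine le_antisymm ?_ h7
        have := real_inner_le_norm (X i) (X j)
        rwa [h4, h5, one_mul] at this
      exact h6.1 ((inner_eq_one_iff_of_norm_eq_one h4 h5).1 h8).symm
    obtain ⟨X, hX⟩ := hF.exists
    exact hX

end

/-- sharpness of the coercivity constant on the sphere: for `μ = σ^{⊗N}`
with `σ` the uniform probability measure on `𝕊^n`, one has
`‖f_φ‖²_{L²(μ)} = ((N−1)/N²)‖φ‖²_{L²(ρ)}` for every admissible `φ`, and consequently the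
infimum of the ratios `‖f_φ‖_{L²(μ)}/‖φ‖_{L²(ρ)}` over nonzero `φ` equals `√(N−1)/N`. -/
theorem sphere_coercivity_sharp
    (n N : ℕ) (hn : 1 ≤ n) (hN : 2 ≤ N)
    (σ : Measure (EuclideanSpace ℝ (Fin (n + 1)))) [IsProbabilityMeasure σ]
    (hσsphere : σ (Metric.sphere (0 : EuclideanSpace ℝ (Fin (n + 1))) 1)ᶜ = 0)
    (hσinv : ∀ O : EuclideanSpace ℝ (Fin (n + 1)) ≃ₗᵢ[ℝ] EuclideanSpace ℝ (Fin (n + 1)),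
      Measure.map O σ = σ)
    (μ : Measure (Fin N → EuclideanSpace ℝ (Fin (n + 1))))
    (hμ : μ = Measure.pi fun _ : Fin N => σ) :
    (∀ φ : ℝ → ℝ, Measurable φ → sphereRhoSqNorm n N μ φ ≠ ⊤ →
      sphereFieldSqNorm n N μ φ =
        (((N - 1 : ℕ) : ℝ≥0∞) / ((N : ℝ≥0∞) ^ 2)) * sphereRhoSqNorm n N μ φ) ∧
    sInf {r : ℝ | ∃ φ : ℝ → ℝ, Measurable φ ∧ sphereRhoSqNorm n N μ φ ≠ 0 ∧
        sphereRhoSqNorm n N μ φ ≠ ⊤ ∧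
        r = Real.sqrt (sphereFieldSqNorm n N μ φ).toReal /
          Real.sqrt (sphereRhoSqNorm n N μ φ).toReal} =
      Real.sqrt ((N : ℝ) - 1) / (N : ℝ) := by
  subst hμ
  refine ⟨fun φ hφ hfin => main_identity hn hN hσsphere hσinv φ hφ hfin, ?_⟩
  have hN1 : (1 : ℝ) ≤ N := by exact_mod_cast (by omega : 1 ≤ N)
  have hratio : ∀ φ : ℝ → ℝ, Measurable φ →
      sphereRhoSqNorm n N (Measure.pi fun _ : Fin N => σ) φ ≠ 0 →
      sphereRhoSqNorm n N (Measure.pi fun _ : Fin N => σ) φ ≠ ⊤ →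
      Real.sqrt (sphereFieldSqNorm n N (Measure.pi fun _ : Fin N => σ) φ).toReal /
        Real.sqrt (sphereRhoSqNorm n N (Measure.pi fun _ : Fin N => σ) φ).toReal =
      Real.sqrt ((N : ℝ) - 1) / (N : ℝ) := by
    intro φ hφ h0 ht
    have hpos := ENNReal.toReal_pos h0 ht
    rw [main_identity hn hN hσsphere hσinv φ hφ ht, ENNReal.toReal_mul,
      Real.sqrt_mul ENNReal.toReal_nonneg, mul_div_assoc, div_self (Real.sqrt_pos.2 hpos).ne',
      mul_one, ENNReal.toReal_div, ENNReal.toReal_pow, ENNReal.toReal_natCast,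
      ENNReal.toReal_natCast, Nat.cast_sub (by omega : 1 ≤ N), Nat.cast_one,
      Real.sqrt_div (by linarith), Real.sqrt_sq (by linarith)]
  refine Eq.trans (congrArg sInf ?_) (csInf_singleton (Real.sqrt ((N : ℝ) - 1) / (N : ℝ)))
  ext r
  simp only [Set.mem_ofPred_eq, Set.mem_singleton_iff]
  constructor
  · rintro ⟨φ, hφ, h0, ht, rfl⟩
    exact hratio φ hφ h0 ht
  · rintro rfl
    have h0 := rho_one_ne_zero (σ := σ) hn hN hσsphere hσinv
    have ht := rho_one_ne_top (σ := σ) hN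
    exact ⟨fun _ => 1, measurable_const, h0, ht, (hratio _ measurable_const h0 ht).symm⟩
end

section
/- Fix integers n ≥ 1 and N ≥ 2, let σ be the uniform (normalized surface) probability measure on 𝕊^n ⊂ ℝ^{n+1}, and let μ be a Borel probability measure on (𝕊^n)^N absolutely continuous with respect to the product measure σ^{⊗N}. For i ≠ j let P_{ij}(X) := d(x_i, x_j) = arccos⟨x_i, x_j⟩ for X = (x_1,…,x_N) ∈ (𝕊^n)^N, and define the positive measure ρ on [0,π] by ρ(B) := (1/(N(N−1))) Σ_{i ≠ j} ∫_{P_{ij}⁻¹(B)} d(x_i,x_j)² dμ(X) for Borel B ⊆ [0,π]. Then ρ is absolutely continuous with respect to the one-dimensional Lebesgue measure on [0,π]. -/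
open MeasureTheory Finset
open scoped ENNReal RealInnerProductSpace

lemma aux_line {n : ℕ} (B : Set ℝ) (hB0 : volume B = 0)
    (y v : EuclideanSpace ℝ (Fin (n + 1))) (hy : ‖y‖ = 1)
    (hv : v ∉ Submodule.span ℝ {y}) :
    volume {t : ℝ | sphereDist (‖v + t • y‖⁻¹ • (v + t • y)) y ∈ B} = 0 := by
  set w := v - ⟪v, y⟫ • y with hw
  have hw0 : w ≠ 0 := by
    intro h
    apply hv
    rw [sub_eq_zero.1 h]
    exact Submodule.smul_mem _ _ (Submodule.mem_span_singleton_self y)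
  have hyy : ⟪y, y⟫ = 1 := by rw [real_inner_self_eq_norm_sq, hy]; norm_num
  have hwy : ⟪w, y⟫ = 0 := by
    rw [hw, inner_sub_left, real_inner_smul_left, hyy]; ring
  let g : ℝ → ℝ := fun θ => ‖w‖ * (Real.cos θ / Real.sin θ) - ⟪v, y⟫
  have hg : volume (g '' (B ∩ {θ | Real.sin θ ≠ 0})) = 0 := by
    apply addHaar_image_eq_zero_of_differentiableOn_of_addHaar_eq_zero
    · intro θ hθ
      have h2 : Real.sin θ ≠ 0 := hθ.2
      apply DifferentiableAt.differentiableWithinAt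
      simp only [g]
      fun_prop (disch := assumption)
    · exact measure_mono_null Set.inter_subset_left hB0
  refine measure_mono_null ?_ hg
  intro t ht
  have ht' : Real.arccos ⟪‖v + t • y‖⁻¹ • (v + t • y), y⟫ ∈ B := ht
  rw [real_inner_smul_left] at ht'
  set s := t + ⟪v, y⟫ with hs
  have hdec : v + t • y = w + s • y := by
    rw [hw, hs]; module
  have hin : ⟪v + t • y, y⟫ = s := by
    rw [hdec, inner_add_left, hwy, real_inner_smul_left, hyy]; ring
  have hnorm : ‖v + t • y‖ ^ 2 = ‖w‖ ^ 2 + s ^ 2 := by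
    rw [hdec, norm_add_sq_real, real_inner_smul_right, hwy, norm_smul, hy, Real.norm_eq_abs,
      mul_one, sq_abs]
    ring
  rw [hin] at ht'
  set r := ‖v + t • y‖ with hr
  have hwpos : 0 < ‖w‖ := norm_pos_iff.2 hw0
  have hr0 : 0 ≤ r := norm_nonneg _
  have hrpos : 0 < r := by
    rcases hr0.lt_or_eq with h | h
    · exact h
    · rw [← h] at hnorm; nlinarith [sq_nonneg s]
  have habs : |s| ≤ r := abs_le_of_sq_le_sq (by nlinarith [sq_nonneg ‖w‖]) hr0
  have hcos : Real.cos (Real.arccos (r⁻¹ * s)) = r⁻¹ * s := by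
    have := abs_le.1 habs
    apply Real.cos_arccos
    · rw [inv_mul_eq_div, le_div_iff₀ hrpos]; linarith
    · rw [inv_mul_eq_div, div_le_iff₀ hrpos]; linarith
  have hsin : Real.sin (Real.arccos (r⁻¹ * s)) = r⁻¹ * ‖w‖ := by
    rw [Real.sin_arccos]
    have : 1 - (r⁻¹ * s) ^ 2 = (r⁻¹ * ‖w‖) ^ 2 := by
      field_simp
      linarith
    rw [this, Real.sqrt_sq (by positivity)]
  refine ⟨_, ⟨ht', ?_⟩, ?_⟩
  · simp only [Set.mem_ofPred_eq, hsin]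
    positivity
  · simp only [g, hcos, hsin]
    field_simp
    rw [hs]; ring

lemma aux_meas {n : ℕ} : Measurable
    (fun p : EuclideanSpace ℝ (Fin (n + 1)) × EuclideanSpace ℝ (Fin (n + 1)) =>
      sphereDist p.1 p.2) := by
  unfold sphereDist
  exact Real.continuous_arccos.measurable.comp (measurable_fst.inner measurable_snd)

lemma aux_meas_comp {n : ℕ} {α : Type*} [MeasurableSpace α]
    {f g : α → EuclideanSpace ℝ (Fin (n + 1))} (hf : Measurable f) (hg : Measurable g) :
    Measurable (fun a => sphereDist (f a) (g a)) := by
  unfold sphereDist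
  exact Real.continuous_arccos.measurable.comp (hf.inner hg)

lemma aux_vol {n : ℕ} (hn : 1 ≤ n) (B : Set ℝ) (hB : MeasurableSet B) (hB0 : volume B = 0)
    (y : EuclideanSpace ℝ (Fin (n + 1))) (hy : ‖y‖ = 1) :
    ∀ᵐ v : EuclideanSpace ℝ (Fin (n + 1)), sphereDist (‖v‖⁻¹ • v) y ∉ B := by
  have hspan : (volume : Measure (EuclideanSpace ℝ (Fin (n + 1))))
      (Submodule.span ℝ {y} : Set _) = 0 := by
    apply Measure.addHaar_submodule
    intro h
    have h1 := finrank_span_singleton (K := ℝ) (v := y) (by rintro rfl; simp at hy)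
    rw [h, finrank_top, finrank_euclideanSpace_fin] at h1
    omega
  have hmeas : Measurable (fun v : EuclideanSpace ℝ (Fin (n + 1)) =>
      sphereDist (‖v‖⁻¹ • v) y) := by
    have h : Measurable (fun v : EuclideanSpace ℝ (Fin (n + 1)) => ‖v‖⁻¹ • v) := by
      fun_prop
    exact aux_meas_comp h measurable_const
  have key : ∀ᵐ v : EuclideanSpace ℝ (Fin (n + 1)),
      v ∈ {v | sphereDist (‖v‖⁻¹ • v) y ∉ B} ∪ (Submodule.span ℝ {y} : Set _) := by
    refine ae_mem_of_ae_add_linearMap_mem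
      (LinearMap.toSpanSingleton ℝ (EuclideanSpace ℝ (Fin (n + 1))) y) volume volume ?_ ?_
    · refine MeasurableSet.union (hmeas hB).compl ?_
      exact (Submodule.closed_of_finiteDimensional _).measurableSet
    · intro v
      by_cases hv : v ∈ Submodule.span ℝ {y}
      · refine Filter.Eventually.of_forall fun t => Or.inr ?_
        exact Submodule.add_mem _ hv
          (Submodule.smul_mem _ _ (Submodule.mem_span_singleton_self y))
      · have := aux_line B hB0 y v hy hv
        have h2 : ∀ᵐ t : ℝ, ¬ sphereDist (‖v + t • y‖⁻¹ • (v + t • y)) y ∈ B := by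
          rw [ae_iff]; simpa using this
        filter_upwards [h2] with t ht
        exact Or.inl ht
  have h3 : ∀ᵐ v : EuclideanSpace ℝ (Fin (n + 1)), v ∉ (Submodule.span ℝ {y} : Set _) :=
    measure_eq_zero_iff_ae_notMem.1 hspan
  filter_upwards [key, h3] with v h1 h2
  exact h1.resolve_right h2

lemma aux_sigma {n : ℕ} (hn : 1 ≤ n)
    (σ : Measure (EuclideanSpace ℝ (Fin (n + 1)))) [IsProbabilityMeasure σ]
    (hσsphere : σ (Metric.sphere (0 : EuclideanSpace ℝ (Fin (n + 1))) 1)ᶜ = 0)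
    (hσinv : ∀ O : EuclideanSpace ℝ (Fin (n + 1)) ≃ₗᵢ[ℝ] EuclideanSpace ℝ (Fin (n + 1)),
      Measure.map O σ = σ)
    (B : Set ℝ) (hB : MeasurableSet B) (hB0 : volume B = 0)
    (x : EuclideanSpace ℝ (Fin (n + 1))) (hx : ‖x‖ = 1) :
    ∀ᵐ y ∂σ, sphereDist x y ∉ B := by
  have hmeas : Measurable (fun p : EuclideanSpace ℝ (Fin (n + 1)) ×
      EuclideanSpace ℝ (Fin (n + 1)) => sphereDist (‖p.1‖⁻¹ • p.1) p.2) := by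
    have h : Measurable (fun p : EuclideanSpace ℝ (Fin (n + 1)) ×
      EuclideanSpace ℝ (Fin (n + 1)) => ‖p.1‖⁻¹ • p.1) := by
      fun_prop
    exact aux_meas_comp h measurable_snd
  have hsph : ∀ᵐ y ∂σ, ‖y‖ = 1 := by
    filter_upwards [measure_eq_zero_iff_ae_notMem.1 hσsphere] with y hy
    simpa using hy
  have h1 : ∀ᵐ y ∂σ, ∀ᵐ v : EuclideanSpace ℝ (Fin (n + 1)),
      sphereDist (‖v‖⁻¹ • v) y ∉ B := by
    filter_upwards [hsph] with y hy using aux_vol hn B hB hB0 y hy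
  have h2 := (Measure.ae_ae_comm (μ := (volume : Measure (EuclideanSpace ℝ (Fin (n + 1)))))
    (ν := σ) (p := fun v y => sphereDist (‖v‖⁻¹ • v) y ∉ B) (hmeas hB).compl).2 h1
  have h3 : ∀ᵐ v : EuclideanSpace ℝ (Fin (n + 1)), v ≠ 0 := by
    rw [ae_iff]; simp
  obtain ⟨v, hv, hv0⟩ := (h2.and h3).exists
  have hu : ‖‖v‖⁻¹ • v‖ = 1 := by
    rw [norm_smul, norm_inv, norm_norm, inv_mul_cancel₀ (norm_ne_zero_iff.2 hv0)]
  generalize ‖v‖⁻¹ • v = u at hv hu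
  let O := Submodule.reflection (Submodule.span ℝ {x - u})ᗮ
  have hO : O x = u := Submodule.reflection_sub (hx.trans hu.symm)
  rw [← hσinv O] at hv
  have := ae_of_ae_map O.continuous.measurable.aemeasurable hv
  filter_upwards [this] with y hy
  rw [← hO] at hy
  unfold sphereDist at hy ⊢
  rwa [O.inner_map_map] at hy

/-- on the sphere, the pairwise geodesic-distance occupancy measure `ρ`,
built from a configuration measure `μ ≪ σ^{⊗N}`, is absolutely continuous with respect
to Lebesgue measure on `ℝ`. -/
theorem sphere_rho_absolutelyContinuous
    (n N : ℕ) (hn : 1 ≤ n) (hN : 2 ≤ N)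
    (σ : Measure (EuclideanSpace ℝ (Fin (n + 1)))) [IsProbabilityMeasure σ]
    (hσsphere : σ (Metric.sphere (0 : EuclideanSpace ℝ (Fin (n + 1))) 1)ᶜ = 0)
    (hσinv : ∀ O : EuclideanSpace ℝ (Fin (n + 1)) ≃ₗᵢ[ℝ] EuclideanSpace ℝ (Fin (n + 1)),
      Measure.map O σ = σ)
    (μ : Measure (Fin N → EuclideanSpace ℝ (Fin (n + 1)))) [IsProbabilityMeasure μ]
    (hμ : μ ≪ Measure.pi fun _ : Fin N => σ)
    (ρ : Measure ℝ)
    (hρ : ρ = ((N * (N - 1) : ℕ) : ℝ≥0∞)⁻¹ •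
      ∑ i : Fin N, ∑ j ∈ Finset.univ.erase i,
        Measure.map (fun X : Fin N → EuclideanSpace ℝ (Fin (n + 1)) =>
            sphereDist (X i) (X j))
          (μ.withDensity fun X => ENNReal.ofReal ((sphereDist (X i) (X j)) ^ 2))) :
    ρ ≪ volume := by
  refine Measure.AbsolutelyContinuous.mk fun B hB hB0 => ?_
  rw [hρ, Measure.smul_apply, Measure.finsetSum_apply]
  refine smul_eq_zero_of_right _ (Finset.sum_eq_zero fun i _ => ?_)
  rw [Measure.finsetSum_apply]
  refine Finset.sum_eq_zero fun j hj => ?_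
  have hij : i ≠ j := (Finset.ne_of_mem_erase hj).symm
  have hm : Measurable (fun X : Fin N → EuclideanSpace ℝ (Fin (n + 1)) => (X i, X j)) := by
    fun_prop
  have hm2 : Measurable (fun X : Fin N → EuclideanSpace ℝ (Fin (n + 1)) =>
      sphereDist (X i) (X j)) := aux_meas_comp (measurable_pi_apply i) (measurable_pi_apply j)
  rw [Measure.map_apply hm2 hB]
  apply withDensity_absolutelyContinuous
  apply hμ
  have hind := (ProbabilityTheory.iIndepFun_pi (μ := fun _ : Fin N => σ)
    (X := fun _ => id) (fun _ => aemeasurable_id)).indepFun hij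
  have hmap := (ProbabilityTheory.indepFun_iff_map_prod_eq_prod_map_map
    (measurable_pi_apply i).aemeasurable (measurable_pi_apply j).aemeasurable).1 hind
  have he : ∀ k : Fin N, Measure.map (fun X : Fin N → EuclideanSpace ℝ (Fin (n + 1)) => X k)
      (Measure.pi fun _ : Fin N => σ) = σ := fun k =>
    (measurePreserving_eval (fun _ : Fin N => σ) k).map_eq
  rw [he, he] at hmap
  have hS := aux_meas (n := n) hB
  have : (σ.prod σ) ((fun p => sphereDist p.1 p.2) ⁻¹' B) = 0 := by
    rw [Measure.measure_prod_null hS]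
    filter_upwards [measure_eq_zero_iff_ae_notMem.1 hσsphere] with x hx
    have := aux_sigma hn σ hσsphere hσinv B hB hB0 x (by simpa using hx)
    exact measure_eq_zero_iff_ae_notMem.2 this
  rw [← hmap, Measure.map_apply hm hS] at this
  exact this
end
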